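/- Gaussian concentration for Lipschitz functions: if h : ℝⁿ → ℝ is L-Lipschitz and θ ∼ N(0, σ²Iₙ), then there is a universal constant C > 0 such that P(|h(θ) − E[h(θ)]| > ε) ≤ 2·exp(−C ε²/(L²σ²)) for all ε > 0; note the bound is dimension-free. -/

import Mathlib

open MeasureTheory ProbabilityTheory
open scoped NNReal ENNReal

/-- One-dimensional Brunn–Minkowski inequality for midpoints of compact sets. -/
lemma IsCompact.volume_add_le_two_mul_of_midpoint_mem {A B C : Set ℝ} (hA : IsCompact A)
    (hB : IsCompact B) (hA' : A.Nonempty) (hB' : B.Nonempty)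
    (h : ∀ x ∈ A, ∀ y ∈ B, (x + y) / 2 ∈ C) :
    volume A + volume B ≤ 2 * volume C := by
  obtain ⟨a, haA, ha⟩ := hA.exists_isGreatest hA'
  obtain ⟨b, hbB, hb⟩ := hB.exists_isLeast hB'
  have hsub : (fun x => x + -b) ⁻¹' A ∪ (fun y => y + -a) ⁻¹' B ⊆ (fun z => 2⁻¹ * z) ⁻¹' C := by
    rintro z (hz | hz)
    · have := h _ hz _ hbB
      simp only [Set.mem_preimage]
      convert this using 1
      ring
    · have := h _ haA _ hz
      simp only [Set.mem_preimage]
      convert this using 1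
      ring
  have hinter : (fun x => x + -b) ⁻¹' A ∩ (fun y => y + -a) ⁻¹' B ⊆ {a + b} := by
    rintro z ⟨hz₁, hz₂⟩
    have h₁ := ha hz₁
    have h₂ := hb hz₂
    simp only [Set.mem_singleton_iff]
    linarith
  have hBm : MeasurableSet ((fun y => y + -a) ⁻¹' B) :=
    hB.measurableSet.preimage (by fun_prop)
  have key := measure_union_add_inter (μ := volume) ((fun x => x + -b) ⁻¹' A) hBm
  rw [measure_preimage_add_right, measure_preimage_add_right,
    measure_mono_null hinter (by simp), add_zero] at key
  rw [← key]
  refine (measure_mono hsub).trans_eq ?_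
  rw [Real.volume_preimage_mul_left (by norm_num)]
  norm_num

/-- One-dimensional Brunn–Minkowski inequality for midpoints of measurable sets. -/
lemma MeasurableSet.volume_add_le_two_mul_of_midpoint_mem {A B C : Set ℝ} (hA : MeasurableSet A)
    (hB : MeasurableSet B) (hA' : A.Nonempty) (hB' : B.Nonempty)
    (h : ∀ x ∈ A, ∀ y ∈ B, (x + y) / 2 ∈ C) :
    volume A + volume B ≤ 2 * volume C := by
  obtain ⟨a, ha⟩ := hA'
  obtain ⟨b, hb⟩ := hB'
  rw [hA.measure_eq_iSup_isCompact, hB.measure_eq_iSup_isCompact]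
  simp only [iSup_and']
  refine ENNReal.biSup_add_biSup_le' (p := fun K => K ⊆ A ∧ IsCompact K)
    (q := fun K => K ⊆ B ∧ IsCompact K) ⟨∅, by simp⟩ ⟨∅, by simp⟩ ?_
  rintro K ⟨hKA, hK⟩ K' ⟨hKB, hK'⟩
  refine le_trans (add_le_add (measure_mono (Set.subset_insert a K))
    (measure_mono (Set.subset_insert b K'))) ?_
  exact (hK.insert a).volume_add_le_two_mul_of_midpoint_mem (hK'.insert b)
    (Set.insert_nonempty _ _) (Set.insert_nonempty _ _)
    fun x hx y hy => h x (Set.insert_subset ha hKA hx) y (Set.insert_subset hb hKB hy)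

lemma ENNReal.mul_le_sq_of_add_le_two_mul {p q r : ℝ≥0∞} (h : p + q ≤ 2 * r) : p * q ≤ r ^ 2 := by
  by_cases hr : r = ⊤
  · simp [hr]
  have hpq : p + q ≠ ⊤ := (h.trans_lt (ENNReal.mul_lt_top (by simp) (lt_top_iff_ne_top.2 hr))).ne
  obtain ⟨hp, hq⟩ := ENNReal.add_ne_top.1 hpq
  lift p to ℝ≥0 using hp
  lift q to ℝ≥0 using hq
  lift r to ℝ≥0 using hr
  norm_cast at h ⊢
  rw [← NNReal.coe_le_coe] at h ⊢
  push_cast at h ⊢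
  nlinarith [sq_nonneg ((p : ℝ) - q), p.coe_nonneg, q.coe_nonneg, r.coe_nonneg]

/-- The Prékopa–Leindler inequality on the line, for midpoints and functions with supremum one,
in its additive form. -/
lemma lintegral_add_le_two_mul_of_midpoint {u v w : ℝ → ℝ} (hu : Measurable u) (hv : Measurable v)
    (hw : Measurable w) (hu0 : 0 ≤ u) (hv0 : 0 ≤ v) (hw0 : 0 ≤ w)
    (hu1 : IsLUB (Set.range u) 1) (hv1 : IsLUB (Set.range v) 1)
    (h : ∀ x y, u x * v y ≤ w ((x + y) / 2) ^ 2) :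
    (∫⁻ x, .ofReal (u x)) + ∫⁻ x, .ofReal (v x) ≤ 2 * ∫⁻ x, .ofReal (w x) := by
  have hmeas : ∀ f : ℝ → ℝ, Measurable fun t : ℝ => volume {x | t < f x} := fun f =>
    Antitone.measurable fun s t hst => measure_mono fun x hx => lt_of_le_of_lt hst hx
  rw [lintegral_eq_lintegral_meas_lt _ (.of_forall hu0) hu.aemeasurable,
    lintegral_eq_lintegral_meas_lt _ (.of_forall hv0) hv.aemeasurable,
    lintegral_eq_lintegral_meas_lt _ (.of_forall hw0) hw.aemeasurable,
    ← lintegral_add_left (hmeas u), ← lintegral_const_mul _ (hmeas w)]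
  refine setLIntegral_mono ((hmeas w).const_mul 2) fun t (ht : 0 < t) => ?_
  rcases lt_or_ge t 1 with ht1 | ht1
  · obtain ⟨_, ⟨x₀, rfl⟩, hx₀, -⟩ := hu1.exists_between ht1
    obtain ⟨_, ⟨y₀, rfl⟩, hy₀, -⟩ := hv1.exists_between ht1
    refine MeasurableSet.volume_add_le_two_mul_of_midpoint_mem (measurableSet_lt measurable_const hu)
      (measurableSet_lt measurable_const hv) ⟨x₀, hx₀⟩ ⟨y₀, hy₀⟩ fun x hx y hy => ?_
    refine lt_of_pow_lt_pow_left₀ 2 (hw0 _) (lt_of_lt_of_le ?_ (h x y))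
    rw [sq]
    exact mul_lt_mul'' hx hy ht.le ht.le
  · have hempty : ∀ f : ℝ → ℝ, IsLUB (Set.range f) 1 → {x | t < f x} = ∅ := fun f hf =>
      Set.eq_empty_of_forall_notMem fun x hx =>
        absurd ((hf.1 ⟨x, rfl⟩).trans ht1) (not_le.2 hx)
    simp [hempty u hu1, hempty v hv1]

/-- The Prékopa–Leindler inequality on the line, for midpoints and bounded functions. -/
lemma lintegral_mul_lintegral_le_sq_of_midpoint {u v w : ℝ → ℝ} (hu : Measurable u)
    (hv : Measurable v) (hw : Measurable w) (hu0 : 0 ≤ u) (hv0 : 0 ≤ v) (hw0 : 0 ≤ w)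
    (hub : BddAbove (Set.range u)) (hvb : BddAbove (Set.range v))
    (h : ∀ x y, u x * v y ≤ w ((x + y) / 2) ^ 2) :
    (∫⁻ x, .ofReal (u x)) * ∫⁻ x, .ofReal (v x) ≤ (∫⁻ x, .ofReal (w x)) ^ 2 := by
  have hua := isLUB_ciSup hub
  have hva := isLUB_ciSup hvb
  set a := ⨆ x, u x
  set b := ⨆ x, v x
  have ha0 : 0 ≤ a := (hu0 0).trans (hua.1 ⟨0, rfl⟩)
  have hb0 : 0 ≤ b := (hv0 0).trans (hva.1 ⟨0, rfl⟩)
  rcases ha0.eq_or_lt with ha | ha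
  · have hz : ∀ x, u x = 0 := fun x => le_antisymm (ha ▸ hua.1 ⟨x, rfl⟩) (hu0 x)
    simp [hz]
  rcases hb0.eq_or_lt with hb | hb
  · have hz : ∀ x, v x = 0 := fun x => le_antisymm (hb ▸ hva.1 ⟨x, rfl⟩) (hv0 x)
    simp [hz]
  have hnorm : ∀ (f : ℝ → ℝ) (c : ℝ), 0 < c → IsLUB (Set.range f) c →
      IsLUB (Set.range fun x => c⁻¹ * f x) 1 := by
    intro f c hc hf
    have := hf.mul_left (inv_nonneg.2 hc.le)
    rwa [← Set.range_comp, inv_mul_cancel₀ hc.ne'] at this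
  have hscale : ∀ (f : ℝ → ℝ) (c : ℝ), 0 < c → Measurable f →
      ∫⁻ x, .ofReal (f x) = ENNReal.ofReal c * ∫⁻ x, .ofReal (c⁻¹ * f x) := by
    intro f c hc hf
    rw [← lintegral_const_mul _ (by fun_prop)]
    refine lintegral_congr fun x => ?_
    rw [← ENNReal.ofReal_mul hc.le, mul_inv_cancel_left₀ hc.ne']
  have hs : 0 < √(a * b) := Real.sqrt_pos.2 (mul_pos ha hb)
  have key := ENNReal.mul_le_sq_of_add_le_two_mul <|
    lintegral_add_le_two_mul_of_midpoint (hu.const_mul a⁻¹) (hv.const_mul b⁻¹)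
      (hw.const_mul (√(a * b))⁻¹)
      (fun x => mul_nonneg (inv_nonneg.2 ha0) (hu0 x))
      (fun x => mul_nonneg (inv_nonneg.2 hb0) (hv0 x))
      (fun x => mul_nonneg (inv_nonneg.2 hs.le) (hw0 x))
      (hnorm u a ha hua) (hnorm v b hb hva) fun x y => by
        rw [mul_pow, inv_pow, Real.sq_sqrt (mul_pos ha hb).le, mul_inv, mul_mul_mul_comm]
        exact mul_le_mul_of_nonneg_left (h x y) (by positivity)
  rw [hscale u a ha hu, hscale v b hb hv, hscale w _ hs hw, mul_pow, mul_mul_mul_comm,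
    ← ENNReal.ofReal_mul ha0, ← ENNReal.ofReal_pow hs.le, Real.sq_sqrt (mul_pos ha hb).le]
  gcongr

/-- Maurey's property `(τ)` for the Gaussian measure on the line. -/
lemma lintegral_mul_lintegral_gaussianReal_le_one {v : ℝ≥0} (hv : v ≠ 0) {F G : ℝ → ℝ≥0∞}
    (hF : Measurable F) (hG : Measurable G)
    (h : ∀ x y, F x * G y ≤ .ofReal (Real.exp ((x - y) ^ 2 / (4 * v)))) :
    (∫⁻ x, F x ∂gaussianReal 0 v) * ∫⁻ y, G y ∂gaussianReal 0 v ≤ 1 := by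
  by_cases hF0 : ∀ x, F x = 0
  · simp [hF0]
  by_cases hG0 : ∀ x, G x = 0
  · simp [hG0]
  push Not at hF0 hG0
  obtain ⟨x₀, hx₀⟩ := hF0
  obtain ⟨y₀, hy₀⟩ := hG0
  have hFt : ∀ x, F x ≠ ⊤ := fun x hx => by
    have := h x y₀
    simp [hx, ENNReal.top_mul hy₀] at this
  have hGt : ∀ y, G y ≠ ⊤ := fun y hy => by
    have := h x₀ y
    simp [hy, ENNReal.mul_top hx₀] at this
  have hv' : (0 : ℝ) < v := by positivity
  set p := gaussianPDFReal 0 v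
  have hp : Measurable p := measurable_gaussianPDFReal 0 v
  have hp0 : ∀ x, 0 < p x := fun x => gaussianPDFReal_pos 0 v x hv
  have hple : ∀ x, p x ≤ (√(2 * Real.pi * v))⁻¹ := fun x => by
    simp only [p, gaussianPDFReal]
    refine mul_le_of_le_one_right (by positivity) (Real.exp_le_one_iff.2 ?_)
    rw [neg_div]
    exact neg_nonpos.2 (by positivity)
  have hmid : ∀ x y, (p x * (F x).toReal) * (p y * (G y).toReal) ≤ p ((x + y) / 2) ^ 2 := by
    intro x y
    have h1 : (F x).toReal * (G y).toReal ≤ Real.exp ((x - y) ^ 2 / (4 * v)) := by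
      rw [← ENNReal.toReal_mul]
      exact ENNReal.toReal_le_of_le_ofReal (Real.exp_pos _).le (h x y)
    calc _ = (p x * p y) * ((F x).toReal * (G y).toReal) := by ring
      _ ≤ (p x * p y) * Real.exp ((x - y) ^ 2 / (4 * v)) :=
        mul_le_mul_of_nonneg_left h1 (mul_pos (hp0 x) (hp0 y)).le
      _ = p ((x + y) / 2) ^ 2 := by
        simp only [p, gaussianPDFReal]
        rw [mul_mul_mul_comm, mul_assoc, ← Real.exp_add, ← Real.exp_add, ← sq, mul_pow,
          ← Real.exp_nat_mul]
        congr 2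
        push_cast
        field_simp
        ring
  have hbdd : ∀ x y, (p x * (F x).toReal) * (p y * (G y).toReal) ≤ (√(2 * Real.pi * v))⁻¹ ^ 2 :=
    fun x y => (hmid x y).trans (pow_le_pow_left₀ (hp0 _).le (hple _) 2)
  have hu0 : 0 < p x₀ * (F x₀).toReal := mul_pos (hp0 _) (ENNReal.toReal_pos hx₀ (hFt _))
  have hv0 : 0 < p y₀ * (G y₀).toReal := mul_pos (hp0 _) (ENNReal.toReal_pos hy₀ (hGt _))
  have key := lintegral_mul_lintegral_le_sq_of_midpoint (hp.mul hF.ennreal_toReal)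
    (hp.mul hG.ennreal_toReal) hp (fun x => mul_nonneg (hp0 x).le ENNReal.toReal_nonneg)
    (fun x => mul_nonneg (hp0 x).le ENNReal.toReal_nonneg) (fun x => (hp0 x).le)
    ⟨_, Set.forall_mem_range.2 fun x => (le_div_iff₀ hv0).2 (hbdd x y₀)⟩
    ⟨_, Set.forall_mem_range.2 fun y => (le_div_iff₀' hu0).2 (hbdd x₀ y)⟩ hmid
  have h_int : ∀ H : ℝ → ℝ≥0∞, Measurable H → (∀ x, H x ≠ ⊤) →
      ∫⁻ x, H x ∂gaussianReal 0 v = ∫⁻ x, .ofReal (p x * (H x).toReal) := by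
    intro H hH hHt
    rw [gaussianReal_of_var_ne_zero 0 hv,
      lintegral_withDensity_eq_lintegral_mul _ (measurable_gaussianPDF 0 v) hH]
    refine lintegral_congr fun x => ?_
    rw [ENNReal.ofReal_mul (hp0 x).le, ENNReal.ofReal_toReal (hHt x)]
    rfl
  rw [h_int F hF hFt, h_int G hG hGt]
  refine key.trans_eq ?_
  rw [lintegral_gaussianPDFReal_eq_one 0 hv, one_pow]

/-- Maurey's property `(τ)` for the isotropic Gaussian measure, with a bound that does not
depend on the dimension. -/
lemma lintegral_mul_lintegral_pi_gaussianReal_le_one {v : ℝ≥0} (hv : v ≠ 0) {n : ℕ}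
    {F G : (Fin n → ℝ) → ℝ≥0∞} (hF : Measurable F) (hG : Measurable G)
    (h : ∀ x y, F x * G y ≤ .ofReal (Real.exp ((∑ i, (x i - y i) ^ 2) / (4 * v)))) :
    (∫⁻ x, F x ∂Measure.pi fun _ => gaussianReal 0 v) *
      ∫⁻ y, G y ∂Measure.pi (fun _ => gaussianReal 0 v) ≤ 1 := by
  induction n with
  | zero =>
    rw [Measure.pi_of_empty _ default, lintegral_dirac' _ hF, lintegral_dirac' _ hG]
    simpa using h default default
  | succ n ih =>
    have hcons : Measurable fun z : ℝ × (Fin n → ℝ) => (Fin.cons z.1 z.2 : Fin (n + 1) → ℝ) := by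
      refine measurable_pi_lambda _ fun i => ?_
      refine Fin.cases ?_ (fun j => ?_) i
      · simpa using measurable_fst
      · simpa [Function.comp_def] using (measurable_pi_apply j).comp measurable_snd
    have hsplit : ∀ H : (Fin (n + 1) → ℝ) → ℝ≥0∞, Measurable H →
        ∫⁻ x, H x ∂Measure.pi (fun _ => gaussianReal 0 v) =
          ∫⁻ s, ∫⁻ x, H (Fin.cons s x) ∂Measure.pi (fun _ => gaussianReal 0 v)
            ∂gaussianReal 0 v := by
      intro H hH
      rw [← lintegral_prod (fun z : ℝ × (Fin n → ℝ) => H (Fin.cons z.1 z.2))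
        (hH.comp hcons).aemeasurable,
        ← (measurePreserving_piFinSuccAbove (fun _ : Fin (n + 1) => gaussianReal 0 v)
          0).symm.lintegral_comp hH]
      refine lintegral_congr fun z => ?_
      simp [MeasurableEquiv.piFinSuccAbove, Fin.insertNthEquiv]
    rw [hsplit F hF, hsplit G hG]
    refine lintegral_mul_lintegral_gaussianReal_le_one hv (hF.comp hcons).lintegral_prod_right'
      (hG.comp hcons).lintegral_prod_right' fun s t => ?_
    set E := Real.exp ((s - t) ^ 2 / (4 * v)) with hE
    have hE0 : 0 < E := Real.exp_pos _
    have hEE : ENNReal.ofReal E * ENNReal.ofReal E⁻¹ = 1 := by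
      rw [← ENNReal.ofReal_mul hE0.le, mul_inv_cancel₀ hE0.ne', ENNReal.ofReal_one]
    have hFs : Measurable fun x : Fin n → ℝ => F (Fin.cons s x) :=
      hF.comp (hcons.comp measurable_prodMk_left)
    have hGt : Measurable fun x : Fin n → ℝ => G (Fin.cons t x) :=
      hG.comp (hcons.comp measurable_prodMk_left)
    have key := ih (hFs.const_mul (ENNReal.ofReal E⁻¹)) hGt fun x y => by
      rw [mul_assoc]
      refine (mul_le_mul_right (h (Fin.cons s x) (Fin.cons t y)) _).trans_eq ?_
      rw [Fin.sum_univ_succ, add_div, Real.exp_add, ENNReal.ofReal_mul (Real.exp_pos _).le,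
        ← mul_assoc]
      simp only [Fin.cons_zero, Fin.cons_succ]
      rw [← hE, mul_comm (ENNReal.ofReal E⁻¹), hEE, one_mul]
    rw [lintegral_const_mul _ hFs] at key
    calc _ = ENNReal.ofReal E * (ENNReal.ofReal E⁻¹ * (∫⁻ x, F (Fin.cons s x) ∂_) *
          ∫⁻ y, G (Fin.cons t y) ∂_) := by rw [← mul_assoc, ← mul_assoc, hEE, one_mul]
      _ ≤ _ := (mul_le_mul_right key _).trans_eq (mul_one _)

/-- A measurable function `h` is sub-Gaussian around its mean as soon as the product of the
exponential moments of `h` and `-h` is bounded by a Gaussian one. -/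
lemma hasSubgaussianMGF_sub_integral_of_lintegral_mul_le {Ω : Type*} [MeasurableSpace Ω]
    {μ : Measure Ω} [IsProbabilityMeasure μ] {h : Ω → ℝ} (hm : Measurable h) {c : ℝ≥0}
    (H : ∀ t : ℝ, (∫⁻ ω, .ofReal (Real.exp (t * h ω)) ∂μ) *
      ∫⁻ ω, .ofReal (Real.exp (-(t * h ω))) ∂μ ≤ .ofReal (Real.exp (c * t ^ 2 / 2))) :
    HasSubgaussianMGF (fun ω => h ω - ∫ ω', h ω' ∂μ) c μ := by
  have hexp : ∀ t : ℝ, Integrable (fun ω => Real.exp (t * h ω)) μ := by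
    intro t
    refine (lintegral_ofReal_ne_top_iff_integrable (by fun_prop)
      (.of_forall fun _ => (Real.exp_pos _).le)).1 fun htop => ?_
    have hne : ∫⁻ ω, .ofReal (Real.exp (-(t * h ω))) ∂μ ≠ 0 := by
      rw [Ne, lintegral_eq_zero_iff (by fun_prop)]
      intro h0
      obtain ⟨ω, hω⟩ := h0.exists
      exact absurd hω (by simp [Real.exp_pos])
    have := H t
    rw [htop, ENNReal.top_mul hne] at this
    simp at this
  have h_int : Integrable h μ := by
    refine integrable_of_mem_interior_integrableExpSet ?_
    have : integrableExpSet h μ = Set.univ := Set.eq_univ_of_forall hexp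
    simp [this]
  refine ⟨fun t => ?_, fun t => ?_⟩
  · simp only [mul_sub, Real.exp_sub]
    exact (hexp t).div_const _
  have hneg : Integrable (fun ω => Real.exp (-(t * h ω))) μ := by
    simpa only [neg_mul] using hexp (-t)
  have hprod : (∫ ω, Real.exp (t * h ω) ∂μ) * ∫ ω, Real.exp (-(t * h ω)) ∂μ ≤
      Real.exp (c * t ^ 2 / 2) := by
    have := H t
    rw [← ofReal_integral_eq_lintegral_ofReal (hexp t) (.of_forall fun _ => (Real.exp_pos _).le),
      ← ofReal_integral_eq_lintegral_ofReal hneg (.of_forall fun _ => (Real.exp_pos _).le),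
      ← ENNReal.ofReal_mul (integral_nonneg fun _ => (Real.exp_pos _).le)] at this
    exact (ENNReal.ofReal_le_ofReal_iff (Real.exp_pos _).le).1 this
  have hjensen : Real.exp (-(t * ∫ ω, h ω ∂μ)) ≤ ∫ ω, Real.exp (-(t * h ω)) ∂μ := by
    have := convexOn_exp.map_integral_le (μ := μ) (f := fun ω => -(t * h ω))
      Real.continuous_exp.continuousOn isClosed_univ (.of_forall fun _ => Set.mem_univ _)
      (h_int.const_mul t).neg hneg
    rwa [integral_neg, integral_const_mul] at this
  calc mgf (fun ω => h ω - ∫ ω', h ω' ∂μ) μ t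
      = (∫ ω, Real.exp (t * h ω) ∂μ) * Real.exp (-(t * ∫ ω, h ω ∂μ)) := by
        rw [mgf, ← integral_mul_const]
        refine integral_congr_ae (.of_forall fun ω => ?_)
        simp only [← Real.exp_add]
        ring_nf
    _ ≤ (∫ ω, Real.exp (t * h ω) ∂μ) * ∫ ω, Real.exp (-(t * h ω)) ∂μ :=
        mul_le_mul_of_nonneg_left hjensen (integral_nonneg fun _ => (Real.exp_pos _).le)
    _ ≤ _ := hprod

/-- A function which is `L`-Lipschitz for the Euclidean norm is sub-Gaussian around its mean under
an isotropic Gaussian measure of variance `v`, with variance proxy `2 L² v`. -/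
lemma hasSubgaussianMGF_pi_gaussianReal_of_lipschitz {v : ℝ≥0} (hv : v ≠ 0) {n : ℕ} {L : ℝ≥0}
    {h : (Fin n → ℝ) → ℝ}
    (hL : ∀ a b : Fin n → ℝ, |h a - h b| ≤ L * √(∑ i, (a i - b i) ^ 2)) :
    HasSubgaussianMGF (fun θ => h θ - ∫ θ', h θ' ∂Measure.pi fun _ => gaussianReal 0 v)
      (2 * L ^ 2 * v) (Measure.pi fun _ => gaussianReal 0 v) := by
  have hcont : Continuous h := by
    refine continuous_iff_continuousAt.2 fun b => tendsto_iff_dist_tendsto_zero.2 ?_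
    refine squeeze_zero (fun _ => dist_nonneg) (fun a => hL a b) ?_
    have : Continuous fun a : Fin n → ℝ => L * √(∑ i, (a i - b i) ^ 2) := by fun_prop
    simpa using this.tendsto b
  have hm := hcont.measurable
  refine hasSubgaussianMGF_sub_integral_of_lintegral_mul_le hm fun t => ?_
  have hv' : (0 : ℝ) < v := by positivity
  set E := Real.exp (t ^ 2 * L ^ 2 * v) with hE
  have hE0 : 0 < E := Real.exp_pos _
  have key := lintegral_mul_lintegral_pi_gaussianReal_le_one (n := n) hv
    (F := fun x => ENNReal.ofReal E⁻¹ * ENNReal.ofReal (Real.exp (t * h x)))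
    (G := fun x => ENNReal.ofReal (Real.exp (-(t * h x)))) (by fun_prop) (by fun_prop) ?_
  · rw [lintegral_const_mul _ (by fun_prop), mul_assoc] at key
    have hc : ((2 * L ^ 2 * v : ℝ≥0) : ℝ) * t ^ 2 / 2 = t ^ 2 * L ^ 2 * v := by
      push_cast
      ring
    rw [hc]
    rwa [ENNReal.ofReal_inv_of_pos hE0, ENNReal.inv_mul_le_iff (by simpa using hE0) (by simp),
      mul_one] at key
  · intro x y
    rw [← ENNReal.ofReal_mul (by positivity), ← ENNReal.ofReal_mul (by positivity), hE,
      ← Real.exp_neg, ← Real.exp_add, ← Real.exp_add]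
    refine ENNReal.ofReal_le_ofReal (Real.exp_le_exp.2 ?_)
    set S := ∑ i, (x i - y i) ^ 2
    have hS : √S ^ 2 = S := Real.sq_sqrt (by positivity)
    have h1 : t * h x - t * h y ≤ |t| * (L * √S) := by
      rw [← mul_sub]
      refine (le_abs_self _).trans ?_
      rw [abs_mul]
      exact mul_le_mul_of_nonneg_left (hL x y) (abs_nonneg t)
    have h2 : |t| * (L * √S) ≤ t ^ 2 * L ^ 2 * v + S / (4 * v) := by
      have : t ^ 2 * L ^ 2 * v + S / (4 * v) - |t| * (L * √S)
          = (2 * v * (|t| * L) - √S) ^ 2 / (4 * v) := by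
        rw [← sq_abs t]
        nth_rw 1 [← hS]
        field_simp
        ring
      have h3 : 0 ≤ (2 * v * (|t| * L) - √S) ^ 2 / (4 * v) := by positivity
      linarith
    linarith

/-- Gaussian concentration for Lipschitz functions: there is a universal constant `C > 0`
such that for any dimension `n`, any `L`-Lipschitz (w.r.t. the Euclidean norm)
`h : ℝⁿ → ℝ` and `θ ∼ N(0, σ²Iₙ)`,
`P(|h(θ) - E[h(θ)]| > ε) ≤ 2·exp(-C ε²/(L²σ²))` for all `ε > 0`. -/
theorem gaussian_concentration_lipschitz :
    ∃ C : ℝ, 0 < C ∧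
      ∀ (n : ℕ) (L σ : ℝ), 0 < L → 0 < σ →
        ∀ h : (Fin n → ℝ) → ℝ,
          (∀ a b : Fin n → ℝ,
            |h a - h b| ≤ L * Real.sqrt (∑ i, (a i - b i) ^ 2)) →
          ∀ ε : ℝ, 0 < ε →
            (Measure.pi fun _ : Fin n => gaussianReal 0 (⟨σ ^ 2, sq_nonneg σ⟩ : ℝ≥0))
              {θ | ε < |h θ - ∫ θ', h θ' ∂(Measure.pi fun _ : Fin n =>
                  gaussianReal 0 (⟨σ ^ 2, sq_nonneg σ⟩ : ℝ≥0))|}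
              ≤ ENNReal.ofReal (2 * Real.exp (-(C * ε ^ 2) / (L ^ 2 * σ ^ 2))) := by
  refine ⟨1 / 4, by norm_num, fun n L σ hL hσ h hLip ε hε => ?_⟩
  lift L to ℝ≥0 using hL.le
  set v : ℝ≥0 := ⟨σ ^ 2, sq_nonneg σ⟩ with hv_def
  have hvσ : (v : ℝ) = σ ^ 2 := rfl
  have hv : v ≠ 0 := by
    rw [← NNReal.coe_ne_zero, hvσ]
    positivity
  set μ := Measure.pi fun _ : Fin n => gaussianReal 0 v
  have hsub := hasSubgaussianMGF_pi_gaussianReal_of_lipschitz hv hLip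
  have h₁ := hsub.measure_ge_le hε.le
  have h₂ := hsub.neg.measure_ge_le hε.le
  have hexp : -ε ^ 2 / (2 * ((2 * L ^ 2 * v : ℝ≥0) : ℝ)) =
      -(1 / 4 * ε ^ 2) / ((L : ℝ) ^ 2 * σ ^ 2) := by
    push_cast
    rw [hvσ]
    field_simp
    norm_num
  rw [hexp] at h₁ h₂
  rw [← ofReal_measureReal]
  refine ENNReal.ofReal_le_ofReal ?_
  rw [two_mul]
  refine le_trans (le_trans (measureReal_mono ?_) (measureReal_union_le _ _)) (add_le_add h₁ h₂)
  intro θ (hθ : ε < |_|)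
  rcases lt_abs.1 hθ with hθ | hθ
  · exact Or.inl hθ.le
  · exact Or.inr hθ.le
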